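/- Let (P_t)_{t≥0} be a Markov transition semigroup on a Polish metric space 𝒳. For T, t₁ > 0 and any Borel probability measure μ on 𝒳, the total variation distance satisfies ‖Q^T(Q^{t₁}μ) − Q^T μ‖_TV ≤ t₁/T. More generally, for any k ≥ 1 and fixed t₁, …, t_k > 0, limsup_{T→∞} sup_{μ∈𝓜₁} ‖Q^{T,t_k,…,t₁}μ − Q^T μ‖_TV = 0, where Q^{t_k,…,t₁}μ := Q^{t_k}(⋯(Q^{t₁}μ)⋯). -/

import Mathlib

open MeasureTheory Filter Topology Metric Set

noncomputable section

/-- A Markov transition semigroup on a measurable space `X`: a jointly measurable family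
of Markov probability kernels `P t x` with `P 0 x = δ_x` and the Chapman–Kolmogorov
semigroup property for nonnegative times. -/
structure MarkovSemigroup (X : Type*) [MeasurableSpace X] where
  P : ℝ → X → MeasureTheory.Measure X
  prob : ∀ t x, MeasureTheory.IsProbabilityMeasure (P t x)
  meas : Measurable fun p : ℝ × X => P p.1 p.2
  init : ∀ x : X, P 0 x = MeasureTheory.Measure.dirac x
  semigroup : ∀ t s : ℝ, 0 ≤ t → 0 ≤ s → ∀ x : X,
    P (t + s) x = (P t x).bind (P s)

namespace MarkovSemigroup

variable {X : Type*} [MeasurableSpace X]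

/-- Action `P_t f(x) = ∫ f(y) P_t(x,dy)` on functions. -/
def act (M : MarkovSemigroup X) (t : ℝ) (f : X → ℝ) (x : X) : ℝ :=
  ∫ y, f y ∂(M.P t x)

/-- Dual action `P_t^* μ` on measures. -/
def dual (M : MarkovSemigroup X) (t : ℝ) (μ : MeasureTheory.Measure X) :
    MeasureTheory.Measure X :=
  μ.bind (M.P t)

/-- The time average `Q^T μ = (1/T) ∫_0^T P_s^* μ ds` (with the convention
`Q^T μ = μ` for `T ≤ 0`). -/
def QM (M : MarkovSemigroup X) (T : ℝ) (μ : MeasureTheory.Measure X) :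
    MeasureTheory.Measure X :=
  if T ≤ 0 then μ
  else ((ENNReal.ofReal (1 / T)) • (volume.restrict (Set.Ioc (0 : ℝ) T))).bind
    fun s => M.dual s μ

/-- `Q^T(x,·) := Q^T δ_x`. -/
def Q (M : MarkovSemigroup X) (T : ℝ) (x : X) : MeasureTheory.Measure X :=
  M.QM T (MeasureTheory.Measure.dirac x)

/-- Iterated averages: for `ts = [t_k, …, t_1]`, `QMs ts μ = Q^{t_k}(⋯(Q^{t_1} μ)⋯)`. -/
def QMs (M : MarkovSemigroup X) (ts : List ℝ) (μ : MeasureTheory.Measure X) :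
    MeasureTheory.Measure X :=
  ts.foldr (fun t ν => M.QM t ν) μ

/-- A measure is invariant if `P_t^* μ = μ` for all `t ≥ 0`. -/
def Invariant (M : MarkovSemigroup X) (μ : MeasureTheory.Measure X) : Prop :=
  ∀ t : ℝ, 0 ≤ t → M.dual t μ = μ

section TopologicalDefs

variable [TopologicalSpace X]

/-- Bounded continuous real functions. -/
def IsBddContinuous (f : X → ℝ) : Prop :=
  Continuous f ∧ ∃ C : ℝ, ∀ x, |f x| ≤ C

/-- The Feller property: `P_t` maps bounded continuous functions to continuous ones. -/
def Feller (M : MarkovSemigroup X) : Prop :=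
  ∀ t : ℝ, 0 ≤ t → ∀ f : X → ℝ, MarkovSemigroup.IsBddContinuous f →
    Continuous (M.act t f)

/-- Stochastic continuity: `P_t f(x) → f(x)` as `t → 0+`. -/
def StochasticallyContinuous (M : MarkovSemigroup X) : Prop :=
  ∀ f : X → ℝ, MarkovSemigroup.IsBddContinuous f → ∀ x : X,
    Filter.Tendsto (fun t : ℝ => M.act t f x) (nhdsWithin 0 (Set.Ioi 0)) (nhds (f x))

/-- Weak convergence of `Q^T ν` to `μ` as `T → ∞`. -/
def QTendsto (M : MarkovSemigroup X) (ν μ : MeasureTheory.Measure X) : Prop :=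
  ∀ f : X → ℝ, MarkovSemigroup.IsBddContinuous f →
    Filter.Tendsto (fun T : ℝ => ∫ x, f x ∂(M.QM T ν)) Filter.atTop
      (nhds (∫ x, f x ∂μ))

/-- Weak-* mean ergodicity with limit `μstar`. -/
def WeakStarMeanErgodic (M : MarkovSemigroup X) (μstar : MeasureTheory.Measure X) : Prop :=
  ∀ ν : MeasureTheory.Measure X, MeasureTheory.IsProbabilityMeasure ν → M.QTendsto ν μstar

/-- Tightness of the family `(Q^T(x,·))_{T>0}`. -/
def TightAt (M : MarkovSemigroup X) (x : X) : Prop :=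
  ∀ ε : ℝ, 0 < ε → ∃ K : Set X, IsCompact K ∧
    ∀ T : ℝ, 0 < T → 1 - ε ≤ ((M.Q T x) K).toReal

end TopologicalDefs

end MarkovSemigroup

/-- Topological support of a measure: points all of whose open neighborhoods
have positive mass. -/
def msupport {X : Type*} [MeasurableSpace X] [TopologicalSpace X]
    (μ : MeasureTheory.Measure X) : Set X :=
  {x : X | ∀ U : Set X, IsOpen U → x ∈ U → 0 < μ U}

/-- Total variation distance between two (finite) measures, as the supremum over
Borel sets of the discrepancy of masses. -/
def tvDist {X : Type*} [MeasurableSpace X] (μ ν : MeasureTheory.Measure X) : ℝ :=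
  ⨆ B : {B : Set X // MeasurableSet B}, |(μ B.1).toReal - (ν B.1).toReal|

section MetricDefs

variable {X : Type*} [MeasurableSpace X] [PseudoMetricSpace X]

/-- Bounded Lipschitz real functions. -/
def IsBddLipschitz (ψ : X → ℝ) : Prop :=
  (∃ K : NNReal, LipschitzWith K ψ) ∧ ∃ C : ℝ, ∀ x, |ψ x| ≤ C

/-- The e-property: equicontinuity of `(P_t ψ)_{t ≥ 0}` at every point, for every
bounded Lipschitz `ψ`. -/
def MarkovSemigroup.EProperty (M : MarkovSemigroup X) : Prop :=
  ∀ ψ : X → ℝ, IsBddLipschitz ψ → ∀ x : X, ∀ ε : ℝ, 0 < ε →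
    ∃ δ : ℝ, 0 < δ ∧ ∀ z : X, dist z x < δ → ∀ t : ℝ, 0 ≤ t →
      |M.act t ψ z - M.act t ψ x| < ε

end MetricDefs

namespace MarkovSemigroup

variable {X : Type*} [MeasurableSpace X]

lemma measurable_P (M : MarkovSemigroup X) (t : ℝ) : Measurable (M.P t) :=
  M.meas.comp measurable_prodMk_left

instance isProbabilityMeasure_dual (M : MarkovSemigroup X) (t : ℝ) (μ : Measure X)
    [IsProbabilityMeasure μ] : IsProbabilityMeasure (M.dual t μ) :=
  isProbabilityMeasure_bind (M.measurable_P t).aemeasurable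
    (Eventually.of_forall fun x => M.prob t x)

lemma measurable_dual (M : MarkovSemigroup X) (μ : Measure X) [SFinite μ] :
    Measurable fun t => M.dual t μ := by
  refine Measure.measurable_of_measurable_coe _ fun B hB => ?_
  have h : (fun t => M.dual t μ B) = fun t => ∫⁻ x, M.P t x B ∂μ := by
    funext t
    exact Measure.bind_apply hB (M.measurable_P t).aemeasurable
  rw [h]
  exact ((Measure.measurable_coe hB).comp M.meas).lintegral_prod_right'

lemma dual_dual (M : MarkovSemigroup X) {r s : ℝ} (hr : 0 ≤ r) (hs : 0 ≤ s) (μ : Measure X) :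
    M.dual s (M.dual r μ) = M.dual (r + s) μ := by
  unfold dual
  rw [Measure.bind_bind (M.measurable_P r).aemeasurable (M.measurable_P s).aemeasurable]
  congr 1
  funext x
  exact (M.semigroup r s hr hs x).symm

lemma lintegral_QM (M : MarkovSemigroup X) {T : ℝ} (hT : 0 < T) (μ : Measure X) [SFinite μ]
    {f : X → ENNReal} (hf : Measurable f) :
    ∫⁻ x, f x ∂(M.QM T μ) =
      ENNReal.ofReal (1 / T) * ∫⁻ s in Ioc 0 T, ∫⁻ x, f x ∂(M.dual s μ) := by
  rw [QM, if_neg hT.not_ge, Measure.lintegral_bind (M.measurable_dual μ).aemeasurable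
    hf.aemeasurable, lintegral_smul_measure, smul_eq_mul]

lemma QM_apply (M : MarkovSemigroup X) {T : ℝ} (hT : 0 < T) (μ : Measure X) [SFinite μ]
    {B : Set X} (hB : MeasurableSet B) :
    M.QM T μ B = ENNReal.ofReal (1 / T) * ∫⁻ s in Ioc 0 T, M.dual s μ B := by
  rw [QM, if_neg hT.not_ge, Measure.bind_apply hB (M.measurable_dual μ).aemeasurable,
    lintegral_smul_measure, smul_eq_mul]

end MarkovSemigroup

lemma ofReal_one_div_mul_setLIntegral_const {T : ℝ} (hT : 0 < T) (c : ENNReal) :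
    ENNReal.ofReal (1 / T) * ∫⁻ _ in Ioc (0 : ℝ) T, c = c := by
  rw [setLIntegral_const, Real.volume_Ioc, sub_zero, mul_left_comm,
    ← ENNReal.ofReal_mul (by positivity), one_div_mul_cancel hT.ne', ENNReal.ofReal_one, mul_one]

lemma setLIntegral_Ioc_le_ofReal {h : ℝ → ENNReal} (h1 : ∀ s, h s ≤ 1) (a b : ℝ) :
    ∫⁻ s in Ioc a b, h s ≤ ENNReal.ofReal (b - a) :=
  (lintegral_mono h1).trans (by simp)

lemma setLIntegral_Ioc_comp_const_add (h : ℝ → ENNReal) (r T : ℝ) :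
    ∫⁻ s in Ioc 0 T, h (r + s) = ∫⁻ s in Ioc r (r + T), h s := by
  have e := (measurePreserving_add_left (volume : Measure ℝ) r).setLIntegral_comp_preimage_emb
    (measurableEmbedding_addLeft r) h (Ioc r (r + T))
  simpa using e

lemma setLIntegral_Ioc_comp_const_add_le {h : ℝ → ENNReal} (h1 : ∀ s, h s ≤ 1) {r : ℝ}
    (hr : 0 ≤ r) (T : ℝ) :
    ∫⁻ s in Ioc 0 T, h (r + s) ≤ (∫⁻ s in Ioc 0 T, h s) + ENNReal.ofReal r := by
  rw [setLIntegral_Ioc_comp_const_add]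
  calc ∫⁻ s in Ioc r (r + T), h s
      ≤ ∫⁻ s in Ioc 0 T ∪ Ioc T (r + T), h s := by
        refine lintegral_mono_set fun s hs => ?_
        rcases le_or_gt s T with h | h
        · exact Or.inl ⟨hr.trans_lt hs.1, h⟩
        · exact Or.inr ⟨h, hs.2⟩
    _ ≤ (∫⁻ s in Ioc 0 T, h s) + ∫⁻ s in Ioc T (r + T), h s := lintegral_union_le _ _ _
    _ ≤ _ := by
        gcongr
        simpa using setLIntegral_Ioc_le_ofReal h1 T (r + T)

lemma setLIntegral_Ioc_le_comp_const_add {h : ℝ → ENNReal} (h1 : ∀ s, h s ≤ 1) {r : ℝ}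
    (hr : 0 ≤ r) (T : ℝ) :
    ∫⁻ s in Ioc 0 T, h s ≤ (∫⁻ s in Ioc 0 T, h (r + s)) + ENNReal.ofReal r := by
  rw [setLIntegral_Ioc_comp_const_add]
  calc ∫⁻ s in Ioc 0 T, h s
      ≤ ∫⁻ s in Ioc r (r + T) ∪ Ioc 0 r, h s := by
        refine lintegral_mono_set fun s hs => ?_
        rcases le_or_gt s r with h | h
        · exact Or.inr ⟨hs.1, h⟩
        · exact Or.inl ⟨h, by linarith [hs.2]⟩
    _ ≤ (∫⁻ s in Ioc r (r + T), h s) + ∫⁻ s in Ioc 0 r, h s := lintegral_union_le _ _ _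
    _ ≤ _ := by
        gcongr
        simpa using setLIntegral_Ioc_le_ofReal h1 0 r

namespace MarkovSemigroup

variable {X : Type*} [MeasurableSpace X]

lemma isProbabilityMeasure_QM (M : MarkovSemigroup X) (T : ℝ) (μ : Measure X)
    [IsProbabilityMeasure μ] : IsProbabilityMeasure (M.QM T μ) := by
  rcases le_or_gt T 0 with hT | hT
  · rwa [QM, if_pos hT]
  · refine ⟨?_⟩
    rw [M.QM_apply hT μ MeasurableSet.univ]
    simpa only [measure_univ] using ofReal_one_div_mul_setLIntegral_const hT 1

lemma isProbabilityMeasure_QMs (M : MarkovSemigroup X) (ts : List ℝ) (μ : Measure X)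
    [IsProbabilityMeasure μ] : IsProbabilityMeasure (M.QMs ts μ) := by
  induction ts with
  | nil => assumption
  | cons t ts ih => exact M.isProbabilityMeasure_QM t (M.QMs ts μ)

lemma QM_QM_apply (M : MarkovSemigroup X) {T t : ℝ} (hT : 0 < T) (ht : 0 < t)
    (μ : Measure X) [IsProbabilityMeasure μ] {B : Set X} (hB : MeasurableSet B) :
    M.QM T (M.QM t μ) B = ENNReal.ofReal (1 / t) * ∫⁻ r in Ioc 0 t,
      ENNReal.ofReal (1 / T) * ∫⁻ s in Ioc 0 T, M.dual (r + s) μ B := by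
  have := M.isProbabilityMeasure_QM t μ
  have hm : Measurable fun p : ℝ × ℝ => M.dual (p.2 + p.1) μ B :=
    ((Measure.measurable_coe hB).comp (M.measurable_dual μ)).comp
      (measurable_snd.add measurable_fst)
  have hinner : ∀ s ∈ Ioc 0 T, M.dual s (M.QM t μ) B =
      ENNReal.ofReal (1 / t) * ∫⁻ r in Ioc 0 t, M.dual (r + s) μ B := by
    intro s hs
    have hPB : Measurable fun x => M.P s x B :=
      (Measure.measurable_coe hB).comp (M.measurable_P s)
    rw [dual, Measure.bind_apply hB (M.measurable_P s).aemeasurable,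
      M.lintegral_QM ht μ hPB]
    congr 1
    refine setLIntegral_congr_fun measurableSet_Ioc fun r hr => ?_
    rw [← M.dual_dual hr.1.le hs.1.le]
    exact (Measure.bind_apply hB (M.measurable_P s).aemeasurable).symm
  rw [M.QM_apply hT _ hB, setLIntegral_congr_fun measurableSet_Ioc hinner,
    lintegral_const_mul' _ _ ENNReal.ofReal_ne_top,
    lintegral_const_mul' _ _ ENNReal.ofReal_ne_top, mul_left_comm,
    lintegral_lintegral_swap hm.aemeasurable]

lemma abs_QM_QM_sub_QM_le (M : MarkovSemigroup X) {T t : ℝ} (hT : 0 < T) (ht : 0 < t)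
    (μ : Measure X) [IsProbabilityMeasure μ] {B : Set X} (hB : MeasurableSet B) :
    |(M.QM T (M.QM t μ) B).toReal - (M.QM T μ B).toReal| ≤ t / T := by
  have := M.isProbabilityMeasure_QM t μ
  have := M.isProbabilityMeasure_QM T μ
  have := M.isProbabilityMeasure_QM T (M.QM t μ)
  have h1 : ∀ s, M.dual s μ B ≤ 1 := fun s => prob_le_one
  have hscale : ∀ {a b : ENNReal} {r : ℝ}, r ≤ t → a ≤ b + ENNReal.ofReal r →
      ENNReal.ofReal (1 / T) * a ≤ ENNReal.ofReal (1 / T) * b + ENNReal.ofReal (t / T) := by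
    intro a b r hr hab
    calc ENNReal.ofReal (1 / T) * a
        ≤ ENNReal.ofReal (1 / T) * (b + ENNReal.ofReal t) := by
          gcongr
          exact hab.trans (by gcongr)
      _ = _ := by
          rw [mul_add, ← ENNReal.ofReal_mul (by positivity), one_div_mul_eq_div]
  have hle : M.QM T (M.QM t μ) B ≤ M.QM T μ B + ENNReal.ofReal (t / T) := by
    rw [M.QM_QM_apply hT ht μ hB,
      ← ofReal_one_div_mul_setLIntegral_const ht (M.QM T μ B + ENNReal.ofReal (t / T))]
    refine mul_le_mul_right (setLIntegral_mono' measurableSet_Ioc fun r hr => ?_) _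
    rw [M.QM_apply hT μ hB]
    exact hscale hr.2 (setLIntegral_Ioc_comp_const_add_le h1 hr.1.le T)
  have hge : M.QM T μ B ≤ M.QM T (M.QM t μ) B + ENNReal.ofReal (t / T) := by
    rw [M.QM_QM_apply hT ht μ hB, ← ofReal_one_div_mul_setLIntegral_const ht (M.QM T μ B)]
    rw [← ofReal_one_div_mul_setLIntegral_const ht (ENNReal.ofReal (t / T))]
    rw [← mul_add, ← lintegral_add_right _ measurable_const]
    refine mul_le_mul_right (setLIntegral_mono' measurableSet_Ioc fun r hr => ?_) _
    rw [M.QM_apply hT μ hB]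
    exact hscale hr.2 (setLIntegral_Ioc_le_comp_const_add h1 hr.1.le T)
  have htT : 0 ≤ t / T := by positivity
  have key : ∀ {a b : ENNReal}, b ≠ ⊤ → a ≤ b + ENNReal.ofReal (t / T) →
      a.toReal ≤ b.toReal + t / T := by
    intro a b hb hab
    have := ENNReal.toReal_mono (by finiteness) hab
    rwa [ENNReal.toReal_add hb ENNReal.ofReal_ne_top, ENNReal.toReal_ofReal htT] at this
  rw [abs_sub_le_iff]
  constructor
  · linarith [key (measure_ne_top _ _) hle]
  · linarith [key (measure_ne_top _ _) hge]

lemma abs_QM_QMs_sub_QM_le (M : MarkovSemigroup X) {T : ℝ} (hT : 0 < T) {ts : List ℝ}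
    (hts : ∀ t ∈ ts, (0 : ℝ) < t) (μ : Measure X) [IsProbabilityMeasure μ]
    {B : Set X} (hB : MeasurableSet B) :
    |(M.QM T (M.QMs ts μ) B).toReal - (M.QM T μ B).toReal| ≤ ts.sum / T := by
  induction ts with
  | nil => simp [QMs]
  | cons t ts ih =>
    have := M.isProbabilityMeasure_QMs ts μ
    have ht := M.abs_QM_QM_sub_QM_le hT (hts t (by simp)) (M.QMs ts μ) hB
    have ih := ih fun u hu => hts u (by simp [hu])
    rw [List.sum_cons, add_div]
    exact (abs_sub_le _ _ _).trans (add_le_add ht ih)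

end MarkovSemigroup

lemma tvDist_nonneg {X : Type*} [MeasurableSpace X] (μ ν : Measure X) : 0 ≤ tvDist μ ν :=
  Real.iSup_nonneg fun _ => abs_nonneg _


/-- Lemma 2 of the paper. For a Markov semigroup on a Polish space,
`‖Q^T(Q^{t₁}μ) − Q^T μ‖_TV ≤ t₁/T`, and more generally for fixed positive times
`t_1,…,t_k` the total variation distance `‖Q^{T,t_k,…,t_1}μ − Q^T μ‖_TV` tends to `0`
as `T → ∞`, uniformly in the probability measure `μ`. -/
theorem tvDist_QM_comp_le
    {X : Type*} [MetricSpace X] [CompleteSpace X] [SecondCountableTopology X]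
    [MeasurableSpace X] [BorelSpace X]
    (M : MarkovSemigroup X) :
    (∀ T : ℝ, 0 < T → ∀ t₁ : ℝ, 0 < t₁ →
      ∀ μ : MeasureTheory.Measure X, MeasureTheory.IsProbabilityMeasure μ →
        tvDist (M.QM T (M.QM t₁ μ)) (M.QM T μ) ≤ t₁ / T) ∧
    (∀ ts : List ℝ, ts ≠ [] → (∀ t ∈ ts, (0 : ℝ) < t) →
      Filter.limsup
        (fun T : ℝ =>
          ⨆ μ : {μ : MeasureTheory.Measure X // MeasureTheory.IsProbabilityMeasure μ},
            tvDist (M.QM T (M.QMs ts μ.1)) (M.QM T μ.1))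
        Filter.atTop = 0) := by
  refine ⟨fun T hT t ht μ hμ => Real.iSup_le
    (fun B => M.abs_QM_QM_sub_QM_le hT ht μ B.2) (by positivity), fun ts _ hts => ?_⟩
  refine Tendsto.limsup_eq (tendsto_of_tendsto_of_tendsto_of_le_of_le' tendsto_const_nhds
    ((tendsto_const_nhds (x := ts.sum)).div_atTop tendsto_id)
    (Eventually.of_forall fun T => Real.iSup_nonneg fun μ => tvDist_nonneg _ _) ?_)
  filter_upwards [eventually_gt_atTop 0] with T hT
  have hnn : 0 ≤ ts.sum / T := div_nonneg (List.sum_nonneg fun t ht => (hts t ht).le) hT.le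
  refine Real.iSup_le (fun μ => Real.iSup_le (fun B => ?_) hnn) hnn
  have := μ.2
  exact M.abs_QM_QMs_sub_QM_le hT hts μ.1 B.2
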